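/- arXiv:1208.5855 — 6 statements merged into one kernel-verified Lean document; each statement's English description precedes it below -/
import Mathlib

section
/- There exists a greatest admissible pair (F∞, Sπ∞) of subsets of S: the pair (F∞, Sπ∞) is itself admissible, and for every admissible pair (A, B) one has A ⊆ F∞ and B ⊆ Sπ∞. (This is the pair of maximal sets computed by the iterative fixpoint removal procedure of Algorithm 1: F∞ is the maximal subset of F from which Sπ∞ is reachable by a nonzero-length path, and Sπ∞ is the maximal subset of Sπ from which F∞ is reachable by a nonzero-length path.) -/
open scoped ENNReal

/-- A finite path of length `n` w.r.t. transition relation `δ`: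
`δ (r i) (r (i+1))` holds for all `i < n`. -/
def IsPath {S : Type*} (δ : S → S → Prop) (r : ℕ → S) (n : ℕ) : Prop :=
  ∀ i < n, δ (r i) (r (i + 1))

/-- Weight of the finite path `r 0, r 1, …, r n`. -/
noncomputable def pathWeight {S : Type*} (W : S → S → ℝ) (r : ℕ → S) (n : ℕ) : ℝ :=
  ∑ i ∈ Finset.range n, W (r i) (r (i + 1))

/-- Minimum weight `W*(p, B)` of a finite path from `p` ending in a state of `B`,
as an element of `ℝ≥0∞` (`∞` if no such path exists). -/
noncomputable def Wstar {S : Type*} (δ : S → S → Prop) (W : S → S → ℝ)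
    (p : S) (B : Set S) : ℝ≥0∞ :=
  sInf {w : ℝ≥0∞ | ∃ (n : ℕ) (r : ℕ → S), r 0 = p ∧ IsPath δ r n ∧ r n ∈ B ∧
    w = ENNReal.ofReal (pathWeight W r n)}

/-- A pair `(A, B)` is admissible for `(F, Sπ)`:
`A ⊆ F`, `B ⊆ Sπ`, every state of `A` has a finite path with at least one transition
ending in a state of `B`, and every state of `B` has a finite path with at least one
transition ending in a state of `A`. -/
def Admissible {S : Type*} (δ : S → S → Prop) (F Sπ A B : Set S) : Prop :=
  A ⊆ F ∧ B ⊆ Sπ ∧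
  (∀ p ∈ A, ∃ (n : ℕ) (r : ℕ → S), 1 ≤ n ∧ r 0 = p ∧ IsPath δ r n ∧ r n ∈ B) ∧
  (∀ p ∈ B, ∃ (n : ℕ) (r : ℕ → S), 1 ≤ n ∧ r 0 = p ∧ IsPath δ r n ∧ r n ∈ A)

/-- The union of all admissible pairs is admissible. -/
theorem admissible_sUnion {S : Type*} (δ : S → S → Prop) (F Sπ : Set S) :
    Admissible δ F Sπ {p | ∃ A B, Admissible δ F Sπ A B ∧ p ∈ A}
      {p | ∃ A B, Admissible δ F Sπ A B ∧ p ∈ B} := by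
  refine ⟨?_, ?_, ?_, ?_⟩
  · rintro p ⟨A, B, h, hp⟩
    exact h.1 hp
  · rintro p ⟨A, B, h, hp⟩
    exact h.2.1 hp
  · rintro p ⟨A, B, h, hp⟩
    obtain ⟨n, r, hn, h0, hr, hB⟩ := h.2.2.1 p hp
    exact ⟨n, r, hn, h0, hr, A, B, h, hB⟩
  · rintro p ⟨A, B, h, hp⟩
    obtain ⟨n, r, hn, h0, hr, hA⟩ := h.2.2.2 p hp
    exact ⟨n, r, hn, h0, hr, A, B, h, hA⟩

/-- There exists a greatest admissible pair `(F∞, Sπ∞)`: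
it is itself admissible, and every admissible pair is contained in it componentwise. -/
theorem exists_greatest_admissible_pair
    (S : Type*) [Fintype S] (δ : S → S → Prop) (W : S → S → ℝ)
    (hW : ∀ p p', δ p p' → 0 < W p p') (F Sπ : Set S) :
    ∃ Finf Sπinf : Set S, Admissible δ F Sπ Finf Sπinf ∧
      ∀ A B : Set S, Admissible δ F Sπ A B → A ⊆ Finf ∧ B ⊆ Sπinf := by
  exact ⟨_, _, admissible_sUnion δ F Sπ, fun A B h =>
    ⟨fun _ hp => ⟨A, B, h, hp⟩, fun _ hp => ⟨A, B, h, hp⟩⟩⟩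
end

section
/- Let (F∞, Sπ∞) be a greatest admissible pair for (F, Sπ), i.e., (F∞, Sπ∞) is admissible and contains every admissible pair componentwise. If a run ϱ : ℕ → S visits F infinitely often and visits Sπ infinitely often, then for every index k with ϱ k ∈ F one has ϱ k ∈ F∞, and for every index k with ϱ k ∈ Sπ one has ϱ k ∈ Sπ∞. -/
open scoped ENNReal

theorem exists_path_of_run_infinite_visits {S : Type*} {δ : S → S → Prop} {ϱ : ℕ → S}
    (hrun : ∀ k, δ (ϱ k) (ϱ (k + 1))) {B : Set S} (hB : {k | ϱ k ∈ B}.Infinite) (k : ℕ) :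
    ∃ (n : ℕ) (r : ℕ → S), 1 ≤ n ∧ r 0 = ϱ k ∧ IsPath δ r n ∧ r n ∈ B ∩ Set.range ϱ := by
  obtain ⟨m, hm, hkm⟩ := hB.exists_gt k
  refine ⟨m - k, fun i => ϱ (k + i), by omega, rfl, fun i _ => hrun (k + i), ?_, k + (m - k), rfl⟩
  simpa [Nat.add_sub_cancel' hkm.le] using hm

/-- If `(F∞, Sπ∞)` is a greatest admissible pair for `(F, Sπ)` and a run
`ϱ` visits `F` infinitely often and `Sπ` infinitely often, then every state of the run
lying in `F` lies in `F∞`, and every state of the run lying in `Sπ` lies in `Sπ∞`. -/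
theorem mem_greatest_admissible_of_inf_visits
    (S : Type*) [Fintype S] (δ : S → S → Prop) (W : S → S → ℝ)
    (hW : ∀ p p', δ p p' → 0 < W p p') (F Sπ : Set S) (Finf Sπinf : Set S)
    (hadm : Admissible δ F Sπ Finf Sπinf)
    (hgreat : ∀ A B : Set S, Admissible δ F Sπ A B → A ⊆ Finf ∧ B ⊆ Sπinf)
    (ϱ : ℕ → S) (hrun : ∀ k, δ (ϱ k) (ϱ (k + 1)))
    (hF : {k | ϱ k ∈ F}.Infinite) (hSπ : {k | ϱ k ∈ Sπ}.Infinite) :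
    (∀ k, ϱ k ∈ F → ϱ k ∈ Finf) ∧ (∀ k, ϱ k ∈ Sπ → ϱ k ∈ Sπinf) := by
  have hadm_run : Admissible δ F Sπ (F ∩ Set.range ϱ) (Sπ ∩ Set.range ϱ) := by
    refine ⟨Set.inter_subset_left, Set.inter_subset_left, ?_, ?_⟩
    · rintro _ ⟨_, k, rfl⟩
      exact exists_path_of_run_infinite_visits hrun hSπ k
    · rintro _ ⟨_, k, rfl⟩
      exact exists_path_of_run_infinite_visits hrun hF k
  obtain ⟨hA, hB⟩ := hgreat _ _ hadm_run
  exact ⟨fun k hk => hA ⟨hk, k, rfl⟩, fun k hk => hB ⟨hk, k, rfl⟩⟩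
end

section
/- Let (F∞, Sπ∞) be a greatest admissible pair for (F, Sπ). A run ϱ : ℕ → S visits F infinitely often and visits Sπ infinitely often if and only if ϱ visits F∞ infinitely often and visits Sπ∞ infinitely often. (This is Lemma 1 of the paper: a run of the product automaton is accepting, and satisfies the surveillance requirement, iff a state from F∞ and a state from Sπ∞ appear on it infinitely many times.) -/
open scoped ENNReal

/-- If a sequence in a finite type visits `A` infinitely often, then it visits some
single state of `A` infinitely often. -/
theorem exists_mem_infinite_visits {S : Type*} [Finite S] {ϱ : ℕ → S} {A : Set S}
    (h : {k | ϱ k ∈ A}.Infinite) : ∃ a ∈ A, {k | ϱ k = a}.Infinite := by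
  by_contra! hfin
  refine h (((Set.toFinite A).biUnion hfin).subset ?_)
  intro k hk
  exact Set.mem_biUnion (show ϱ k ∈ A from hk) rfl

/-- A run visiting `a` and `b` infinitely often contains a nonempty path from `a` to `b`. -/
theorem exists_path_of_infinite_visits {S : Type*} {δ : S → S → Prop} {ϱ : ℕ → S}
    (hrun : ∀ k, δ (ϱ k) (ϱ (k + 1))) {a b : S}
    (ha : {k | ϱ k = a}.Infinite) (hb : {k | ϱ k = b}.Infinite) :
    ∃ (n : ℕ) (r : ℕ → S), 1 ≤ n ∧ r 0 = a ∧ IsPath δ r n ∧ r n = b := by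
  obtain ⟨i, hi⟩ := ha.nonempty
  obtain ⟨j, hj, hij⟩ := hb.exists_gt i
  refine ⟨j - i, fun k => ϱ (i + k), by omega, hi, fun k _ => hrun (i + k), ?_⟩
  simpa [Nat.add_sub_cancel' hij.le] using hj

/-- **Lemma 1 of the paper.** Let `(F∞, Sπ∞)` be a greatest admissible pair
for `(F, Sπ)`. A run visits `F` infinitely often and `Sπ` infinitely often iff it visits
`F∞` infinitely often and `Sπ∞` infinitely often. -/
theorem inf_visits_iff_inf_visits_greatest
    (S : Type*) [Fintype S] (δ : S → S → Prop) (W : S → S → ℝ)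
    (hW : ∀ p p', δ p p' → 0 < W p p') (F Sπ : Set S) (Finf Sπinf : Set S)
    (hadm : Admissible δ F Sπ Finf Sπinf)
    (hgreat : ∀ A B : Set S, Admissible δ F Sπ A B → A ⊆ Finf ∧ B ⊆ Sπinf)
    (ϱ : ℕ → S) (hrun : ∀ k, δ (ϱ k) (ϱ (k + 1))) :
    ({k | ϱ k ∈ F}.Infinite ∧ {k | ϱ k ∈ Sπ}.Infinite) ↔
      ({k | ϱ k ∈ Finf}.Infinite ∧ {k | ϱ k ∈ Sπinf}.Infinite) := by
  constructor
  · rintro ⟨hF, hS⟩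
    obtain ⟨a, haF, ha⟩ := exists_mem_infinite_visits hF
    obtain ⟨b, hbS, hb⟩ := exists_mem_infinite_visits hS
    obtain ⟨hA, hB⟩ := hgreat {a} {b} ⟨Set.singleton_subset_iff.mpr haF,
      Set.singleton_subset_iff.mpr hbS,
      fun p hp => hp ▸ exists_path_of_infinite_visits hrun ha hb,
      fun p hp => hp ▸ exists_path_of_infinite_visits hrun hb ha⟩
    exact ⟨ha.mono fun _ hk => hA hk, hb.mono fun _ hk => hB hk⟩
  · rintro ⟨hF, hS⟩
    exact ⟨hF.mono fun _ hk => hadm.1 hk, hS.mono fun _ hk => hadm.2.1 hk⟩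
end

section
/- For every subset B ⊆ S and every state p ∉ B with W*(p, B) < ∞, there exists a state p' with δ p p' such that W*(p, B) = W p p' + W*(p', B). In particular the infimum defining W*(p, B) is attained by some finite path, and an optimal path decomposes into one transition followed by an optimal path from its second state. -/
open scoped ENNReal

theorem pathWeight_succ {S : Type*} (W : S → S → ℝ) (r : ℕ → S) (n : ℕ) :
    pathWeight W r (n + 1) = W (r 0) (r 1) + pathWeight W (fun i => r (i + 1)) n := by
  simp only [pathWeight, Finset.sum_range_succ']
  exact add_comm _ _

theorem IsPath.tail {S : Type*} {δ : S → S → Prop} {r : ℕ → S} {n : ℕ}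
    (h : IsPath δ r (n + 1)) : IsPath δ (fun i => r (i + 1)) n :=
  fun i hi => h (i + 1) (Nat.succ_lt_succ hi)

theorem IsPath.pathWeight_nonneg {S : Type*} {δ : S → S → Prop} {W : S → S → ℝ}
    (hW : ∀ p p', δ p p' → 0 ≤ W p p') {r : ℕ → S} {n : ℕ} (h : IsPath δ r n) :
    0 ≤ pathWeight W r n :=
  Finset.sum_nonneg fun i hi => hW _ _ (h i (Finset.mem_range.mp hi))

theorem IsPath.Wstar_le {S : Type*} {δ : S → S → Prop} (W : S → S → ℝ) {B : Set S}
    {r : ℕ → S} {n : ℕ} (h : IsPath δ r n) (hB : r n ∈ B) :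
    Wstar δ W (r 0) B ≤ ENNReal.ofReal (pathWeight W r n) :=
  sInf_le ⟨n, r, rfl, h, hB, rfl⟩

theorem Wstar_le_step_add {S : Type*} {δ : S → S → Prop} {W : S → S → ℝ}
    (hW : ∀ p p', δ p p' → 0 ≤ W p p') (B : Set S) {p p' : S} (hp : δ p p') :
    Wstar δ W p B ≤ ENNReal.ofReal (W p p') + Wstar δ W p' B := by
  rw [Wstar.eq_def δ W p', ENNReal.add_sInf]
  refine le_iInf₂ ?_
  rintro _ ⟨n, r, rfl, hr, hB, rfl⟩
  let q : ℕ → S := fun i => Nat.casesOn i p r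
  have hq : IsPath δ q (n + 1) := by
    rintro (_ | i) hi
    · exact hp
    · exact hr i (Nat.lt_of_succ_lt_succ hi)
  rw [← ENNReal.ofReal_add (hW _ _ hp) (hr.pathWeight_nonneg hW)]
  have hle := hq.Wstar_le W hB
  rwa [pathWeight_succ] at hle

theorem IsPath.step_add_Wstar_le {S : Type*} {δ : S → S → Prop} {W : S → S → ℝ}
    (hW : ∀ p p', δ p p' → 0 ≤ W p p') {B : Set S} {r : ℕ → S} {n : ℕ}
    (h : IsPath δ r (n + 1)) (hB : r (n + 1) ∈ B) :
    ENNReal.ofReal (W (r 0) (r 1)) + Wstar δ W (r 1) B ≤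
      ENNReal.ofReal (pathWeight W r (n + 1)) := by
  rw [pathWeight_succ, ENNReal.ofReal_add (hW _ _ (h 0 n.succ_pos))
    (h.tail.pathWeight_nonneg hW)]
  exact add_le_add_right (h.tail.Wstar_le W hB) _

/-- For `p ∉ B` with `W*(p, B) < ∞`, there is a successor `p'` of `p`
such that `W*(p, B) = W p p' + W*(p', B)`. -/
theorem Wstar_eq_step_add
    (S : Type*) [Fintype S] (δ : S → S → Prop) (W : S → S → ℝ)
    (hW : ∀ p p', δ p p' → 0 < W p p') (B : Set S) (p : S)
    (hp : p ∉ B) (hfin : Wstar δ W p B < ⊤) :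
    ∃ p' : S, δ p p' ∧
      Wstar δ W p B = ENNReal.ofReal (W p p') + Wstar δ W p' B := by
  have hW' : ∀ p p', δ p p' → 0 ≤ W p p' := fun p p' h => (hW p p' h).le
  have hsucc : {p' | δ p p'}.Nonempty := by
    obtain ⟨_, ⟨n, r, rfl, hr, hB, -⟩, -⟩ := sInf_lt_iff.mp hfin
    cases n with
    | zero => exact absurd hB hp
    | succ n => exact ⟨r 1, hr 0 n.succ_pos⟩
  obtain ⟨p', hp', hmin⟩ := Set.exists_min_image {p' | δ p p'}
    (fun p' => ENNReal.ofReal (W p p') + Wstar δ W p' B) (Set.toFinite _) hsucc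
  refine ⟨p', hp', (Wstar_le_step_add hW' B hp').antisymm (le_sInf ?_)⟩
  rintro _ ⟨n, r, rfl, hr, hB, rfl⟩
  cases n with
  | zero => exact absurd hB hp
  | succ n => exact (hmin _ (hr 0 n.succ_pos)).trans (hr.step_add_Wstar_le hW' hB)
end

section
/- Let B ⊆ S, let ϱ : ℕ → S be a run, and let m : ℕ be such that W*(ϱ m, B) < ∞. Suppose that for every k ≥ m with ϱ k ∉ B one has W*(ϱ (k+1), B) < W*(ϱ k, B) (i.e., from index m onward the run always follows transitions that strictly shorten the distance to B). Then there exists k ≥ m with ϱ k ∈ B. (This is the key progress argument in the proof of Theorem 1: since S is finite, W*(·, B) takes only finitely many values, so a run whose distance to B strictly decreases at every step must eventually reach B.) -/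
open scoped ENNReal

/-- **progress argument of Theorem 1.** If from index `m` on a run always
strictly decreases its finite distance to `B` whenever it is outside `B`, then the run
eventually reaches `B`. -/
theorem run_reaches_of_strict_decrease
    (S : Type*) [Fintype S] (δ : S → S → Prop) (W : S → S → ℝ)
    (hW : ∀ p p', δ p p' → 0 < W p p') (B : Set S)
    (ϱ : ℕ → S) (hrun : ∀ k, δ (ϱ k) (ϱ (k + 1))) (m : ℕ)
    (hfin : Wstar δ W (ϱ m) B < ⊤)
    (hdec : ∀ k ≥ m, ϱ k ∉ B → Wstar δ W (ϱ (k + 1)) B < Wstar δ W (ϱ k) B) :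
    ∃ k ≥ m, ϱ k ∈ B := by
  by_contra! hB
  have hanti : StrictAnti fun k => Wstar δ W (ϱ (m + k)) B :=
    strictAnti_nat_of_succ_lt fun k => hdec (m + k) (by omega) (hB (m + k) (by omega))
  exact not_injective_infinite_finite (fun k => ϱ (m + k))
    (Function.Injective.of_comp (f := fun p => Wstar δ W p B) hanti.injective)
end

section
/- Let (A, B) be an admissible pair for (F, Sπ), and let p₀ ∈ S be a state with W*(p₀, A) < ∞ (i.e., p₀ ∈ A or p₀ has a finite path to a state of A). Then there exists a run ϱ : ℕ → S with ϱ 0 = p₀ that visits A infinitely often and visits B infinitely often; in particular ϱ visits F infinitely often and Sπ infinitely often. (This is the completeness direction of Theorem 1: if F∞ is nonempty and reachable from the initial state of the product automaton, an accepting run satisfying the surveillance requirement exists.) -/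
open scoped ENNReal

/-- `x = (p, b, n)` is such that some finite path of length `n` leads from `p` to `T b`. -/
def ReachesTarget {S : Type*} (δ : S → S → Prop) (T : Bool → Set S) (x : S × Bool × ℕ) : Prop :=
  ∃ r : ℕ → S, r 0 = x.1 ∧ IsPath δ r x.2.2 ∧ r x.2.2 ∈ T x.2.1

/-- One step of the run that alternates between two targets: follow the current path while it is
nonempty, and switch to the other target once the current one is attained. -/
theorem ReachesTarget.exists_next {S : Type*} {δ : S → S → Prop} {T : Bool → Set S}
    (hT : ∀ b, ∀ p ∈ T b, ∃ (n : ℕ) (r : ℕ → S), 1 ≤ n ∧ r 0 = p ∧ IsPath δ r n ∧ r n ∈ T (!b))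
    {x : S × Bool × ℕ} (hx : ReachesTarget δ T x) :
    ∃ y, ReachesTarget δ T y ∧ δ x.1 y.1 ∧ (x.2.2 = 0 → y.2.1 = !x.2.1) ∧
      ∀ k, x.2.2 = k + 1 → y.2.2 = k ∧ y.2.1 = x.2.1 := by
  obtain ⟨p, b, n⟩ := x
  obtain ⟨r, rfl, hr, hrn⟩ := hx
  cases n with
  | zero =>
    obtain ⟨m, q, hm, hq0, hq, hqm⟩ := hT b _ hrn
    obtain ⟨k, rfl⟩ := Nat.exists_eq_add_of_le' hm
    refine ⟨(q 1, !b, k), ⟨fun i => q (i + 1), rfl, hq.tail, hqm⟩, ?_, by simp, by simp⟩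
    have h := hq 0 (by omega)
    rwa [hq0] at h
  | succ k =>
    exact ⟨(r 1, b, k), ⟨fun i => r (i + 1), rfl, hr.tail, hrn⟩, hr 0 (Nat.succ_pos k),
      by simp, by simp⟩

/-- If each of two targets can be reached from the other by a nonempty path, then any path to one of
them is followed by a run visiting both infinitely often. -/
theorem exists_run_infinite_visits {S : Type*} {δ : S → S → Prop} {T : Bool → Set S}
    (hT : ∀ b, ∀ p ∈ T b, ∃ (n : ℕ) (r : ℕ → S), 1 ≤ n ∧ r 0 = p ∧ IsPath δ r n ∧ r n ∈ T (!b))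
    {x : S × Bool × ℕ} (hx : ReachesTarget δ T x) :
    ∃ ϱ : ℕ → S, ϱ 0 = x.1 ∧ (∀ k, δ (ϱ k) (ϱ (k + 1))) ∧ ∀ b, {k | ϱ k ∈ T b}.Infinite := by
  choose next hnext hδ hzero hsucc using
    fun y : {y // ReachesTarget δ T y} => y.2.exists_next hT
  let f : ℕ → {y // ReachesTarget δ T y} :=
    fun k => Nat.rec ⟨x, hx⟩ (fun _ y => ⟨next y, hnext y⟩) k
  have attain : ∀ n k, (f k).1.2.2 = n →
      ∃ j ≥ k, (f j).1.2.2 = 0 ∧ (f j).1.2.1 = (f k).1.2.1 := by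
    intro n
    induction n with
    | zero => exact fun k hk => ⟨k, le_rfl, hk, rfl⟩
    | succ n ih =>
      intro k hk
      obtain ⟨hn, hb⟩ := hsucc (f k) n hk
      obtain ⟨j, hj, hj0, hjb⟩ := ih (k + 1) hn
      exact ⟨j, by omega, hj0, hjb.trans hb⟩
  have mem : ∀ j, (f j).1.2.2 = 0 → (f j).1.1 ∈ T (f j).1.2.1 := by
    intro j hj
    obtain ⟨r, hr0, -, hr⟩ := (f j).2
    rwa [hj, hr0] at hr
  refine ⟨fun k => (f k).1.1, rfl, fun k => hδ (f k), fun b => ?_⟩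
  refine Set.infinite_of_forall_exists_gt fun k => ?_
  obtain ⟨j, hj, hj0, -⟩ := attain _ (k + 1) rfl
  by_cases hb : (f j).1.2.1 = b
  · exact ⟨j, hb ▸ mem j hj0, by omega⟩
  · obtain ⟨i, hi, hi0, hib⟩ := attain _ (j + 1) rfl
    have hflip : (f (j + 1)).1.2.1 = !(f j).1.2.1 := hzero (f j) hj0
    have hbi : (f i).1.2.1 = b := by
      rw [hib, hflip]
      exact Bool.not_eq.mpr hb
    exact ⟨i, hbi ▸ mem i hi0, by omega⟩

/-- **completeness direction of Theorem 1.** If `(A, B)` is an admissible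
pair for `(F, Sπ)` and `p₀` has finite distance to `A`, then there is a run from `p₀`
visiting `A` and `B` (hence `F` and `Sπ`) infinitely often. -/
theorem exists_accepting_run_of_admissible
    (S : Type*) [Fintype S] (δ : S → S → Prop) (W : S → S → ℝ)
    (hW : ∀ p p', δ p p' → 0 < W p p') (F Sπ : Set S) (A B : Set S)
    (hadm : Admissible δ F Sπ A B) (p₀ : S) (hreach : Wstar δ W p₀ A < ⊤) :
    ∃ ϱ : ℕ → S, ϱ 0 = p₀ ∧ (∀ k, δ (ϱ k) (ϱ (k + 1))) ∧
      {k | ϱ k ∈ A}.Infinite ∧ {k | ϱ k ∈ B}.Infinite ∧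
      {k | ϱ k ∈ F}.Infinite ∧ {k | ϱ k ∈ Sπ}.Infinite := by
  obtain ⟨hAF, hBS, hAB, hBA⟩ := hadm
  obtain ⟨-, ⟨n, r, hr0, hr, hrn, -⟩, -⟩ := sInf_lt_iff.mp hreach
  obtain ⟨ϱ, h0, hδ, hinf⟩ :=
    exists_run_infinite_visits (δ := δ) (T := fun b => cond b A B) (x := (p₀, true, n))
      (Bool.forall_bool.mpr ⟨hBA, hAB⟩) ⟨r, hr0, hr, hrn⟩
  have hA : {k | ϱ k ∈ A}.Infinite := hinf true
  have hB : {k | ϱ k ∈ B}.Infinite := hinf false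
  exact ⟨ϱ, h0, hδ, hA, hB, hA.mono fun _ hk => hAF hk, hB.mono fun _ hk => hBS hk⟩
end
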